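/- For every natural number n, the number of partitions of 2n all of whose parts are either even or equal to 1 equals ∑_{k=0}^{n} p(k), the sum of the numbers of partitions of 0, 1, …, n. (Equivalently, this count is the coefficient of q^n in 1/((1 − q)(q)_∞).) -/

import Mathlib

namespace Nat.Partition

theorem sum_map_two_mul (s : Multiset ℕ) : (s.map (2 * ·)).sum = 2 * s.sum := by
  simpa using Multiset.sum_map_mul_left (s := s) (a := 2) (f := fun i => i)

/-- Double every part of a partition of `k ≤ n` and append `2 * (n - k)` parts equal to `1`. -/
def doubleAppendOnes (n : ℕ) (x : Σ k : Fin (n + 1), Nat.Partition k) :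
    {p : Nat.Partition (2 * n) // ∀ a ∈ p.parts, Even a ∨ a = 1} where
  val :=
    { parts := x.2.parts.map (2 * ·) + Multiset.replicate (2 * (n - x.1)) 1
      parts_pos := by
        intro i hi
        rcases Multiset.mem_add.1 hi with h | h
        · obtain ⟨a, ha, rfl⟩ := Multiset.mem_map.1 h
          have := x.2.parts_pos ha
          positivity
        · rw [Multiset.eq_of_mem_replicate h]
          exact one_pos
      parts_sum := by
        have := x.1.2
        simp only [Multiset.sum_add, sum_map_two_mul, x.2.parts_sum, Multiset.sum_replicate,
          smul_eq_mul]
        omega }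
  property := by
    intro a ha
    rcases Multiset.mem_add.1 ha with h | h
    · obtain ⟨b, -, rfl⟩ := Multiset.mem_map.1 h
      exact .inl (even_two_mul b)
    · exact .inr (Multiset.eq_of_mem_replicate h)

theorem filter_even_doubleAppendOnes (n : ℕ) (x : Σ k : Fin (n + 1), Nat.Partition k) :
    (doubleAppendOnes n x).1.parts.filter Even = x.2.parts.map (2 * ·) := by
  have h₁ : (x.2.parts.map (2 * ·)).filter Even = x.2.parts.map (2 * ·) := by
    rw [Multiset.filter_eq_self]
    intro a ha
    obtain ⟨b, -, rfl⟩ := Multiset.mem_map.1 ha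
    exact even_two_mul b
  have h₂ : (Multiset.replicate (2 * (n - x.1)) 1).filter Even = 0 := by
    rw [Multiset.filter_eq_nil]
    intro a ha
    rw [Multiset.eq_of_mem_replicate ha]
    exact Nat.not_even_one
  rw [doubleAppendOnes, Multiset.filter_add, h₁, h₂, add_zero]

theorem doubleAppendOnes_injective (n : ℕ) : Function.Injective (doubleAppendOnes n) := by
  intro x y h
  have hparts : x.2.parts = y.2.parts := by
    apply Multiset.map_injective (mul_right_injective₀ (two_ne_zero : (2 : ℕ) ≠ 0))
    rw [← filter_even_doubleAppendOnes, ← filter_even_doubleAppendOnes, h]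
  obtain ⟨k, p⟩ := x
  obtain ⟨l, q⟩ := y
  obtain rfl : k = l := Fin.ext (by rw [← p.parts_sum, ← q.parts_sum, hparts])
  exact congrArg (Sigma.mk k) (Nat.Partition.ext hparts)

theorem doubleAppendOnes_surjective (n : ℕ) : Function.Surjective (doubleAppendOnes n) := by
  rintro ⟨p, hp⟩
  set e := p.parts.filter Even
  have hdouble : (e.map (· / 2)).map (2 * ·) = e := by
    rw [Multiset.map_map]
    conv_rhs => rw [← Multiset.map_id e]
    exact Multiset.map_congr rfl fun a ha =>
      Nat.two_mul_div_two_of_even (Multiset.mem_filter.1 ha).2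
  obtain ⟨m, hones⟩ : ∃ m, p.parts.filter (¬ Even ·) = Multiset.replicate m 1 :=
    ⟨_, Multiset.eq_replicate_card.2 fun a ha =>
      (hp a (Multiset.mem_filter.1 ha).1).resolve_left (Multiset.mem_filter.1 ha).2⟩
  have hsplit : e + Multiset.replicate m 1 = p.parts := by
    rw [← hones]
    exact Multiset.filter_add_not _ _
  have hesum : e.sum = 2 * (e.map (· / 2)).sum := by
    rw [← sum_map_two_mul, hdouble]
  have hsum : 2 * (e.map (· / 2)).sum + m = 2 * n := by
    rw [← hesum, ← p.parts_sum, ← hsplit]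
    simp
  refine ⟨⟨⟨(e.map (· / 2)).sum, by omega⟩, ⟨e.map (· / 2), ?_, rfl⟩⟩, ?_⟩
  · intro i hi
    obtain ⟨a, ha, rfl⟩ := Multiset.mem_map.1 hi
    obtain ⟨ha, b, rfl⟩ := Multiset.mem_filter.1 ha
    have := p.parts_pos ha
    omega
  · refine Subtype.ext (Nat.Partition.ext ?_)
    change (e.map (· / 2)).map (2 * ·) +
      Multiset.replicate (2 * (n - (e.map (· / 2)).sum)) 1 = p.parts
    rw [hdouble, ← hsplit]
    congr 2
    omega

end Nat.Partition

/-- The number of partitions of `2n` all of whose parts are even or equal to `1`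
equals `p(0) + p(1) + ⋯ + p(n)`. -/
theorem partitions_even_or_one (n : ℕ) :
    Nat.card {p : Nat.Partition (2 * n) // ∀ a ∈ p.parts, Even a ∨ a = 1} =
      ∑ k ∈ Finset.range (n + 1), Nat.card (Nat.Partition k) := by
  rw [Finset.sum_range, ← Nat.card_sigma]
  exact (Nat.card_eq_of_bijective _ ⟨Nat.Partition.doubleAppendOnes_injective n,
    Nat.Partition.doubleAppendOnes_surjective n⟩).symm
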